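/- Let Ω ⊆ ℝ^N be a bounded connected open set and u ∈ C²(Ω) ∩ C⁰(Ω̄) be positive with 𝓜(u) = 0 on Ω. Suppose {s_t}_{t∈[0,1)} is a family of positive functions in C²(Ω) ∩ C⁰(Ω̄), depending continuously on t (in the uniform norm on Ω̄), such that 𝓜(s_t) ≥ 0 on Ω for every t ∈ [0,1), s_t < u on ∂Ω for every t ∈ (0,1), and u ≥ s_{t̄} everywhere in Ω for some t̄ ∈ (0,1). Then u ≥ s₀ everywhere in Ω. -/

import Mathlib

open Set
noncomputable section

/-- Euclidean space `ℝ^N`. -/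
abbrev Euc (N : ℕ) := EuclideanSpace ℝ (Fin N)

/-- `i`-th partial derivative `D_i u`. -/
def pd {N : ℕ} (u : Euc N → ℝ) (i : Fin N) (x : Euc N) : ℝ :=
  fderiv ℝ u x (EuclideanSpace.single i 1)

/-- Second partial derivative `D_i D_j u`. -/
def pd2 {N : ℕ} (u : Euc N → ℝ) (i j : Fin N) (x : Euc N) : ℝ :=
  fderiv ℝ (fun z => pd u j z) x (EuclideanSpace.single i 1)

/-- `|Du|²`. -/
def gradSq {N : ℕ} (u : Euc N → ℝ) (x : Euc N) : ℝ := ∑ i, (pd u i x) ^ 2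

/-- The (non-divergence form) symmetric minimal surface operator
`𝓜(u) = Δu − Σ_{i,j} (D_iu D_ju/(1+|Du|²)) D_iD_ju − (m−1)/u`. -/
def smeM (m : ℕ) {N : ℕ} (u : Euc N → ℝ) (x : Euc N) : ℝ :=
  (∑ i, pd2 u i i x)
    - (∑ i, ∑ j, (pd u i x * pd u j x / (1 + gradSq u x)) * pd2 u i j x)
    - ((m : ℝ) - 1) / u x

/-- The second-order part of the operator, as a function of a gradient `p` and a Hessian `H`. -/
def smePrincipal {N : ℕ} (p : Fin N → ℝ) (H : Fin N → Fin N → ℝ) : ℝ :=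
  (∑ i, H i i) - ∑ i, ∑ j, (p i * p j / (1 + ∑ k, p k ^ 2)) * H i j

lemma smeM_eq_smePrincipal (m : ℕ) {N : ℕ} (u : Euc N → ℝ) (x : Euc N) :
    smeM m u x = smePrincipal (fun i => pd u i x) (fun i j => pd2 u i j x) - ((m : ℝ) - 1) / u x :=
  rfl

lemma smePrincipal_add {N : ℕ} (p : Fin N → ℝ) (H K : Fin N → Fin N → ℝ) :
    smePrincipal p (fun i j => H i j + K i j) = smePrincipal p H + smePrincipal p K := by
  simp only [smePrincipal, mul_add, Finset.sum_add_distrib]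
  ring

lemma smePrincipal_const_mul {N : ℕ} (p : Fin N → ℝ) (c : ℝ) (H : Fin N → Fin N → ℝ) :
    smePrincipal p (fun i j => c * H i j) = c * smePrincipal p H := by
  simp only [smePrincipal, mul_sub, Finset.mul_sum]
  congr 1
  exact Finset.sum_congr rfl fun i _ => Finset.sum_congr rfl fun j _ => by ring

lemma smePrincipal_nonpos {N : ℕ} (p : Fin N → ℝ) (B : Euc N →L[ℝ] Euc N →L[ℝ] ℝ)
    (hB : ∀ v, B v v ≤ 0) :
    smePrincipal p (fun i j => B (EuclideanSpace.single i 1) (EuclideanSpace.single j 1)) ≤ 0 := by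
  set e : Fin N → Euc N := fun i => EuclideanSpace.single i 1
  set q : Euc N := ∑ i, p i • e i with hq
  set S : ℝ := ∑ k, p k ^ 2 with hS
  have hS0 : 0 ≤ S := Finset.sum_nonneg fun _ _ => sq_nonneg _
  set V : ℝ := √(1 + S) with hV
  have hV2 : V ^ 2 = 1 + S := Real.sq_sqrt (by linarith)
  have hV0 : 0 < V := Real.sqrt_pos.2 (by linarith)
  set c : ℝ := 1 / (V * (V + 1)) with hc
  have hcS : 2 * c - c ^ 2 * S = 1 / (1 + S) := by
    have : S = V ^ 2 - 1 := by linarith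
    rw [hc, this]
    have : V + 1 ≠ 0 := by positivity
    field_simp
    ring
  have h1 : ∑ k, p k * B (e k) q = B q q := by
    calc ∑ k, p k * B (e k) q = (∑ k, p k • B (e k)) q := by simp
      _ = B q q := by
        rw [hq]
        simp only [map_sum, map_smul]
  have h2 : ∑ k, p k * B q (e k) = B q q := by
    calc ∑ k, p k * B q (e k) = B q (∑ k, p k • e k) := by simp
      _ = B q q := by rw [hq]
  have hqq : B q q = ∑ i, ∑ j, p i * p j * B (e i) (e j) := by
    rw [← h1]
    refine Finset.sum_congr rfl fun i _ => ?_
    rw [hq, map_sum, Finset.mul_sum]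
    refine Finset.sum_congr rfl fun j _ => ?_
    rw [map_smul, smul_eq_mul]
    ring
  have hsum : ∑ k, B (e k - (c * p k) • q) (e k - (c * p k) • q)
      = smePrincipal p (fun i j => B (e i) (e j)) := by
    have h3 : ∀ k, B (e k - (c * p k) • q) (e k - (c * p k) • q)
        = B (e k) (e k) - c * (p k * B (e k) q) - c * (p k * B q (e k))
          + p k ^ 2 * (c ^ 2 * B q q) := by
      intro k
      simp only [map_sub, map_smul, sub_apply, smul_apply,
        smul_eq_mul]
      ring
    simp only [h3, Finset.sum_add_distrib, Finset.sum_sub_distrib, ← Finset.mul_sum,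
      ← Finset.sum_mul, h1, h2, ← hS]
    have h4 : ∑ i, ∑ j, (p i * p j / (1 + S)) * B (e i) (e j) = 1 / (1 + S) * B q q := by
      rw [hqq, Finset.mul_sum]
      refine Finset.sum_congr rfl fun i _ => ?_
      rw [Finset.mul_sum]
      exact Finset.sum_congr rfl fun j _ => by ring
    rw [smePrincipal, h4, ← hcS]
    ring
  change smePrincipal p (fun i j => B (e i) (e j)) ≤ 0
  rw [← hsum]
  exact Finset.sum_nonpos fun k _ => hB _

lemma abs_smePrincipal_sub_le {N : ℕ} (i₀ : Fin N) {P Q : ℝ} (hP : 0 ≤ P)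
    (p : Fin N → ℝ) (H : Fin N → Fin N → ℝ) (hp : ∀ i, |p i| ≤ P) (hH : ∀ i j, |H i j| ≤ Q)
    {τ : ℝ} (hτ0 : 0 ≤ τ) (hτ1 : τ ≤ 1) :
    |smePrincipal (fun i => p i - τ * if i = i₀ then 1 else 0) H - smePrincipal p H|
      ≤ τ * (N * (N * (((P * P) * (2 * P + 1) + (1 + N * P ^ 2) * (2 * P + 1)) * Q))) := by
  set d : Fin N → ℝ := fun i => if i = i₀ then 1 else 0 with hd
  have hd0 : ∀ i, |d i| ≤ 1 := by
    intro i
    simp only [hd]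
    split_ifs <;> simp
  change |smePrincipal (fun i => p i - τ * d i) H - _| ≤ _
  set S : ℝ := ∑ k, p k ^ 2 with hS
  have hS0 : 0 ≤ S := Finset.sum_nonneg fun _ _ => sq_nonneg _
  have hSP : S ≤ N * P ^ 2 := by
    have : S ≤ ∑ _k : Fin N, P ^ 2 := Finset.sum_le_sum fun k _ => sq_le_sq' (by
      linarith [neg_abs_le (p k), hp k]) ((le_abs_self _).trans (hp k))
    simpa using this
  set S' : ℝ := ∑ k, (p k - τ * d k) ^ 2 with hS'
  have hS'0 : 0 ≤ S' := Finset.sum_nonneg fun _ _ => sq_nonneg _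
  have hSS : S' = S - 2 * τ * p i₀ + τ ^ 2 := by
    have h1 : ∀ k, (p k - τ * d k) ^ 2 = p k ^ 2 - 2 * τ * (p k * d k) + τ ^ 2 * (d k) := by
      intro k
      simp only [hd]
      split_ifs <;> ring
    simp only [hS', h1, Finset.sum_add_distrib, Finset.sum_sub_distrib, ← Finset.mul_sum]
    simp [hd, hS]
  have hterm : ∀ i j, |p i * p j / (1 + S) * H i j
      - (p i - τ * d i) * (p j - τ * d j) / (1 + S') * H i j|
      ≤ τ * (((P * P) * (2 * P + 1) + (1 + N * P ^ 2) * (2 * P + 1)) * Q) := by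
    intro i j
    have hQ : 0 ≤ Q := (abs_nonneg _).trans (hH i j)
    have h1 : p i * p j / (1 + S) * H i j - (p i - τ * d i) * (p j - τ * d j) / (1 + S') * H i j
      = τ * (((p i * p j) * (-2 * p i₀ + τ) + (1 + S) * (d i * p j + d j * p i - τ * (d i * d j)))
          * H i j / ((1 + S) * (1 + S'))) := by
      have h2 : 1 + S ≠ 0 := by positivity
      have h3 : 1 + S' ≠ 0 := by positivity
      rw [← sub_eq_zero]
      field_simp
      rw [hSS]
      ring
    rw [h1, abs_mul, abs_of_nonneg hτ0]
    refine mul_le_mul_of_nonneg_left ?_ hτ0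
    rw [abs_div, abs_mul]
    have hden : 1 ≤ |(1 + S) * (1 + S')| := by
      rw [abs_of_nonneg (by positivity)]
      nlinarith
    refine (div_le_self (by positivity) hden).trans ?_
    refine mul_le_mul ?_ (hH i j) (abs_nonneg _) (by positivity)
    refine (abs_add_le _ _).trans (add_le_add ?_ ?_)
    · rw [abs_mul, abs_mul]
      refine mul_le_mul (mul_le_mul (hp i) (hp j) (abs_nonneg _) hP) ?_ (abs_nonneg _)
        (by positivity)
      have := abs_le.1 (hp i₀)
      rw [abs_le]
      constructor <;> linarith
    · rw [abs_mul, abs_of_nonneg (by positivity : 0 ≤ 1 + S)]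
      refine mul_le_mul (by linarith) ?_ (abs_nonneg _) (by positivity)
      have a1 : |d i * p j| ≤ P := by
        rw [abs_mul]
        exact (mul_le_of_le_one_left (abs_nonneg _) (hd0 i)).trans (hp j)
      have a2 : |d j * p i| ≤ P := by
        rw [abs_mul]
        exact (mul_le_of_le_one_left (abs_nonneg _) (hd0 j)).trans (hp i)
      have a3 : |τ * (d i * d j)| ≤ 1 := by
        rw [abs_mul, abs_mul, abs_of_nonneg hτ0]
        exact mul_le_one₀ hτ1 (by positivity) (mul_le_one₀ (hd0 i) (abs_nonneg _) (hd0 j))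
      calc _ ≤ |d i * p j + d j * p i| + |τ * (d i * d j)| := abs_sub _ _
        _ ≤ |d i * p j| + |d j * p i| + |τ * (d i * d j)| := by gcongr; exact abs_add_le _ _
        _ ≤ 2 * P + 1 := by linarith
  have hdiff : smePrincipal (fun i => p i - τ * d i) H - smePrincipal p H
      = ∑ i, ∑ j, (p i * p j / (1 + S) * H i j
        - (p i - τ * d i) * (p j - τ * d j) / (1 + S') * H i j) := by
    simp only [smePrincipal, Finset.sum_sub_distrib, ← hS, ← hS']
    ring
  rw [hdiff]
  calc _ ≤ ∑ _i : Fin N, ∑ _j : Fin N,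
        τ * (((P * P) * (2 * P + 1) + (1 + N * P ^ 2) * (2 * P + 1)) * Q) :=
        (Finset.abs_sum_le_sum_abs _ _).trans (Finset.sum_le_sum fun i _ =>
          (Finset.abs_sum_le_sum_abs _ _).trans (Finset.sum_le_sum fun j _ => hterm i j))
    _ = _ := by
        simp
        ring

lemma inv_le_smePrincipal_single {N : ℕ} (i₀ : Fin N) {P : ℝ} (p : Fin N → ℝ)
    (hp : ∀ i, |p i| ≤ P) :
    1 / (1 + N * P ^ 2) ≤ smePrincipal p (fun i j => if i = i₀ ∧ j = i₀ then 1 else 0) := by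
  set S : ℝ := ∑ k, p k ^ 2 with hS
  have hS0 : 0 ≤ S := Finset.sum_nonneg fun _ _ => sq_nonneg _
  have hSP : S ≤ N * P ^ 2 := by
    have : S ≤ ∑ _k : Fin N, P ^ 2 := Finset.sum_le_sum fun k _ => sq_le_sq' (by
      linarith [neg_abs_le (p k), hp k]) ((le_abs_self _).trans (hp k))
    simpa using this
  have h0 : p i₀ ^ 2 ≤ S :=
    Finset.single_le_sum (f := fun k => p k ^ 2) (fun k _ => sq_nonneg _) (Finset.mem_univ i₀)
  have h1 : smePrincipal p (fun i j => if i = i₀ ∧ j = i₀ then 1 else 0)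
      = 1 - p i₀ ^ 2 / (1 + S) := by
    simp only [smePrincipal, ← hS]
    simp [ite_and, sq (p i₀)]
  rw [h1]
  calc 1 / (1 + N * P ^ 2) ≤ 1 / (1 + S) := by gcongr
    _ ≤ _ := by
      have : 1 + S ≠ 0 := by positivity
      rw [le_sub_iff_add_le, ← add_div]
      exact div_le_one_of_le₀ (by linarith) (by positivity)

lemma deriv_deriv_nonpos_of_isLocalMax {f : ℝ → ℝ} {x : ℝ} (hf : IsLocalMax f x)
    (hc : ContinuousAt f x) : deriv (deriv f) x ≤ 0 := by
  by_contra! h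
  have hmin := isLocalMin_of_deriv_deriv_pos h hf.deriv_eq_zero hc
  have heq : f =ᶠ[nhds x] fun _ => f x := by
    filter_upwards [hf, hmin] with y h1 h2 using le_antisymm h1 h2
  have h2 : deriv (deriv f) x = 0 := by
    rw [heq.deriv.deriv_eq]
    simp
  exact h.ne' h2

lemma fderiv_fderiv_apply_self_nonpos {E : Type*} [NormedAddCommGroup E] [NormedSpace ℝ E]
    {g : E → ℝ} {x : E} (hg : ContDiffAt ℝ 2 g x) (hmax : IsLocalMax g x) (v : E) :
    fderiv ℝ (fderiv ℝ g) x v v ≤ 0 := by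
  have hline : ∀ t : ℝ, HasDerivAt (fun t : ℝ => x + t • v) v t := fun t => by
    simpa using ((hasDerivAt_id t).smul_const v).const_add x
  have hcont : ContinuousAt (fun t : ℝ => x + t • v) 0 := (hline 0).continuousAt
  have hcont' : Filter.Tendsto (fun t : ℝ => x + t • v) (nhds 0) (nhds x) := by
    simpa [ContinuousAt] using hcont
  have hx0 : x + (0 : ℝ) • v = x := by simp
  have h1 : ∀ᶠ t in nhds (0 : ℝ), deriv (fun t : ℝ => g (x + t • v)) t
      = fderiv ℝ g (x + t • v) v := by
    have := hg.eventually (by simp)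
    filter_upwards [hcont'.eventually this] with t ht
    exact ((ht.differentiableAt (by simp)).hasFDerivAt.comp_hasDerivAt t (hline t)).deriv
  have hd : HasFDerivAt (fderiv ℝ g) (fderiv ℝ (fderiv ℝ g) x) (x + (0 : ℝ) • v) := by
    rw [hx0]
    exact ((hg.fderiv_right (m := 1) (by norm_num)).differentiableAt (by simp)).hasFDerivAt
  have h2 : deriv (deriv fun t : ℝ => g (x + t • v)) 0 = fderiv ℝ (fderiv ℝ g) x v v := by
    rw [Filter.EventuallyEq.deriv_eq h1]
    have h3 : HasDerivAt (fun t : ℝ => fderiv ℝ g (x + t • v)) (fderiv ℝ (fderiv ℝ g) x v) 0 :=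
      hd.comp_hasDerivAt (0 : ℝ) (hline 0)
    have h4 := h3.clm_apply (hasDerivAt_const (0 : ℝ) v)
    rw [h4.deriv]
    simp
  rw [← h2]
  refine deriv_deriv_nonpos_of_isLocalMax ?_ ?_
  · have := hcont'.eventually hmax
    simpa [IsLocalMax, IsMaxFilter] using this
  · exact ContinuousAt.comp (g := g) (by rw [hx0]; exact hg.continuousAt) hcont

lemma pd2_eq_fderiv_fderiv {N : ℕ} {u : Euc N → ℝ} {x : Euc N} (hu : ContDiffAt ℝ 2 u x)
    (i j : Fin N) :
    pd2 u i j x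
      = fderiv ℝ (fderiv ℝ u) x (EuclideanSpace.single i 1) (EuclideanSpace.single j 1) := by
  have hd : HasFDerivAt (fderiv ℝ u) (fderiv ℝ (fderiv ℝ u) x) x :=
    ((hu.fderiv_right (m := 1) (by norm_num)).differentiableAt (by simp)).hasFDerivAt
  have := (hd.clm_apply (hasFDerivAt_const (EuclideanSpace.single j (1 : ℝ) : Euc N) x)).fderiv
  simp only [pd2, pd]
  rw [this]
  simp

lemma pd_add {N : ℕ} {u v : Euc N → ℝ} {x : Euc N} (hu : DifferentiableAt ℝ u x)
    (hv : DifferentiableAt ℝ v x) (i : Fin N) :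
    pd (fun z => u z + v z) i x = pd u i x + pd v i x := by
  simp [pd, fderiv_fun_add hu hv]

lemma pd_const_mul {N : ℕ} (c : ℝ) (u : Euc N → ℝ) (x : Euc N) (i : Fin N) :
    pd (fun z => c * u z) i x = c * pd u i x := by
  have h : fderiv ℝ (fun z => c * u z) = c • fderiv ℝ u := fderiv_const_smul_field c
  simp [pd, h]

lemma differentiableAt_pd {N : ℕ} {u : Euc N → ℝ} {x : Euc N} (hu : ContDiffAt ℝ 2 u x)
    (i : Fin N) : DifferentiableAt ℝ (fun z => pd u i z) x :=
  ((hu.fderiv_right (m := 1) (by norm_num)).differentiableAt (by simp)).clm_apply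
    (differentiableAt_const _)

lemma pd2_add {N : ℕ} {u v : Euc N → ℝ} {x : Euc N} (hu : ContDiffAt ℝ 2 u x)
    (hv : ContDiffAt ℝ 2 v x) (i j : Fin N) :
    pd2 (fun z => u z + v z) i j x = pd2 u i j x + pd2 v i j x := by
  have h : (fun z => pd (fun y => u y + v y) j z) =ᶠ[nhds x] fun z => pd u j z + pd v j z := by
    filter_upwards [hu.eventually (by simp), hv.eventually (by simp)] with z h1 h2
    exact pd_add (h1.differentiableAt (by simp)) (h2.differentiableAt (by simp)) j
  simp only [pd2, h.fderiv_eq,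
    fderiv_fun_add (differentiableAt_pd hu j) (differentiableAt_pd hv j)]
  simp

lemma pd2_const_mul {N : ℕ} (c : ℝ) (u : Euc N → ℝ) (x : Euc N) (i j : Fin N) :
    pd2 (fun z => c * u z) i j x = c * pd2 u i j x := by
  simp only [pd2, pd_const_mul]
  exact pd_const_mul c (fun z => pd u j z) x i

lemma pd_exp_coord {N : ℕ} (α : ℝ) (i₀ i : Fin N) (x : Euc N) :
    pd (fun z : Euc N => Real.exp (α * z i₀)) i x
      = α * (if i = i₀ then 1 else 0) * Real.exp (α * x i₀) := by
  have h : HasFDerivAt (fun z : Euc N => z i₀) (EuclideanSpace.proj i₀ : Euc N →L[ℝ] ℝ) x :=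
    (EuclideanSpace.proj i₀ : Euc N →L[ℝ] ℝ).hasFDerivAt
  rw [pd, (h.const_mul α).exp.fderiv]
  simp [eq_comm, mul_comm]

lemma pd2_exp_coord {N : ℕ} (α : ℝ) (i₀ i j : Fin N) (x : Euc N) :
    pd2 (fun z : Euc N => Real.exp (α * z i₀)) i j x
      = α ^ 2 * Real.exp (α * x i₀) * (if i = i₀ ∧ j = i₀ then 1 else 0) := by
  simp only [pd2, pd_exp_coord]
  have := pd_const_mul (α * (if j = i₀ then 1 else 0)) (fun z : Euc N => Real.exp (α * z i₀)) x i
  rw [pd_exp_coord] at this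
  refine this.trans ?_
  by_cases h1 : i = i₀ <;> by_cases h2 : j = i₀ <;> simp [h1, h2]
  ring

lemma contDiff_exp_coord {N : ℕ} (α : ℝ) (i₀ : Fin N) :
    ContDiff ℝ 2 fun z : Euc N => Real.exp (α * z i₀) :=
  (contDiff_const.mul (EuclideanSpace.proj i₀ : Euc N →L[ℝ] ℝ).contDiff).exp

/-- At an interior maximum of `s - u + η exp (α x_{i₀})` where `s ≤ u`, the operator cannot be
nonnegative on `s` and nonpositive on `u` when `α` is large with respect to the derivatives
of `u`. -/
lemma smeM_not_nonneg_of_isLocalMax {m N : ℕ} (hm : 1 ≤ m) (i₀ : Fin N) {u s : Euc N → ℝ}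
    {x : Euc N} (hu : ContDiffAt ℝ 2 u x) (hs : ContDiffAt ℝ 2 s x)
    (hspos : 0 < s x) (hsu : s x ≤ u x) {P Q α η : ℝ} (hP : 0 ≤ P) (hp : ∀ i, |pd u i x| ≤ P)
    (hH : ∀ i j, |pd2 u i j x| ≤ Q) (hα : 0 < α) (hη : 0 < η)
    (hηα : η * (α * Real.exp (α * x i₀)) ≤ 1)
    (hαlarge : N * (N * (((P * P) * (2 * P + 1) + (1 + N * P ^ 2) * (2 * P + 1)) * Q))
      < α * (1 / (1 + N * (P + 1) ^ 2)))
    (hmax : IsLocalMax (fun z => s z + (-1) * u z + η * Real.exp (α * z i₀)) x)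
    (husol : smeM m u x ≤ 0) : smeM m s x < 0 := by
  have hφ : ContDiffAt ℝ 2 (fun z : Euc N => Real.exp (α * z i₀)) x :=
    (contDiff_exp_coord α i₀).contDiffAt
  have hu' : ContDiffAt ℝ 2 (fun z => (-1) * u z) x := contDiffAt_const.mul hu
  have hφ' : ContDiffAt ℝ 2 (fun z : Euc N => η * Real.exp (α * z i₀)) x := contDiffAt_const.mul hφ
  have hsu' : ContDiffAt ℝ 2 (fun z => s z + (-1) * u z) x := hs.add hu'
  have hg := hsu'.add hφ'
  set τ : ℝ := η * (α * Real.exp (α * x i₀)) with hτ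
  have hτ0 : 0 < τ := by positivity
  set B := fderiv ℝ (fderiv ℝ fun z => s z + (-1) * u z + η * Real.exp (α * z i₀)) x with hBdef
  have hgrad : (fun i => pd s i x) = fun i => pd u i x - τ * if i = i₀ then 1 else 0 := by
    funext i
    have h1 : pd (fun z => s z + (-1) * u z + η * Real.exp (α * z i₀)) i x = 0 := by
      rw [pd, hmax.fderiv_eq_zero]
      rfl
    rw [pd_add (hsu'.differentiableAt (by simp)) (hφ'.differentiableAt (by simp)),
      pd_add (hs.differentiableAt (by simp)) (hu'.differentiableAt (by simp)), pd_const_mul,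
      pd_const_mul, pd_exp_coord] at h1
    rw [hτ]
    linarith
  have hhess : (fun i j => pd2 s i j x) = fun i j => pd2 u i j x +
      (B (EuclideanSpace.single i 1) (EuclideanSpace.single j 1)
        + (-(α * τ)) * if i = i₀ ∧ j = i₀ then 1 else 0) := by
    funext i j
    have h1 := pd2_eq_fderiv_fderiv hg i j
    rw [← hBdef, pd2_add hsu' hφ', pd2_add hs hu', pd2_const_mul, pd2_const_mul,
      pd2_exp_coord] at h1
    rw [← h1, hτ]
    ring
  have hp' : ∀ i, |pd u i x - τ * if i = i₀ then 1 else 0| ≤ P + 1 := by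
    intro i
    have := abs_le.1 (hp i)
    rw [abs_le]
    split_ifs <;> constructor <;> linarith
  have e1 := abs_le.1 (abs_smePrincipal_sub_le i₀ hP (fun i => pd u i x) (fun i j => pd2 u i j x)
    hp hH hτ0.le hηα)
  have e2 := smePrincipal_nonpos (fun i => pd u i x - τ * if i = i₀ then 1 else 0) B
    (fderiv_fderiv_apply_self_nonpos hg hmax)
  have e3 := inv_le_smePrincipal_single i₀ _ hp'
  have e4 : ((m : ℝ) - 1) / u x ≤ ((m : ℝ) - 1) / s x := by
    have : (1 : ℝ) ≤ m := by exact_mod_cast hm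
    exact div_le_div_of_nonneg_left (by linarith) hspos hsu
  rw [smeM_eq_smePrincipal] at husol ⊢
  rw [hgrad, hhess, smePrincipal_add, smePrincipal_add, smePrincipal_const_mul]
  have e5 := mul_lt_mul_of_pos_left hαlarge hτ0
  have e6 := mul_le_mul_of_nonneg_left e3 (by positivity : 0 ≤ α * τ)
  linarith [e1.2]

lemma exists_abs_le_of_continuousOn {X ι : Type*} [TopologicalSpace X] [Finite ι]
    {K : Set X} (hK : IsCompact K) {f : ι → X → ℝ} (hf : ∀ i, ContinuousOn (f i) K) :
    ∃ C, 0 ≤ C ∧ ∀ x ∈ K, ∀ i, |f i x| ≤ C := by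
  have := Fintype.ofFinite ι
  choose C hC using fun i => hK.exists_bound_of_continuousOn (hf i)
  refine ⟨∑ i, |C i|, Finset.sum_nonneg fun _ _ => abs_nonneg _, fun x hx i => ?_⟩
  exact ((hC i x hx).trans (le_abs_self _)).trans
    (Finset.single_le_sum (f := fun i => |C i|) (fun _ _ => abs_nonneg _) (Finset.mem_univ i))

/-- Continuous functions with `s < u` on a compact set are separated by a positive gap. -/
lemma IsCompact.exists_gap {X : Type*} [TopologicalSpace X] {K : Set X} (hK : IsCompact K)
    {s u : X → ℝ} (hs : ContinuousOn s K) (hu : ContinuousOn u K) (h : ∀ x ∈ K, s x < u x) :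
    ∃ δ > 0, ∀ x ∈ K, s x + δ ≤ u x := by
  obtain ⟨δ, hδ, hle⟩ := hK.exists_forall_le' (a := 0) (hu.sub hs) fun x hx => sub_pos.2 (h x hx)
  exact ⟨δ, hδ, fun x hx => by
    have : δ ≤ u x - s x := hle x hx
    linarith⟩

/-- Touching principle: a subsolution lying below a supersolution, strictly on the boundary,
lies strictly below it in the interior. -/
lemma smeM_lt_of_le {m N : ℕ} (hm : 1 ≤ m) (hN : 1 ≤ N) {Ω : Set (Euc N)} (hΩ : IsOpen Ω)
    (hbdd : Bornology.IsBounded Ω) {u s : Euc N → ℝ}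
    (hu2 : ContDiffOn ℝ 2 u Ω) (hu0 : ContinuousOn u (closure Ω))
    (hs2 : ContDiffOn ℝ 2 s Ω) (hs0 : ContinuousOn s (closure Ω))
    (hspos : ∀ x ∈ Ω, 0 < s x) (husol : ∀ x ∈ Ω, smeM m u x ≤ 0)
    (hsub : ∀ x ∈ Ω, 0 ≤ smeM m s x) (hle : ∀ x ∈ Ω, s x ≤ u x)
    (hbdry : ∀ x ∈ frontier Ω, s x < u x) : ∀ x ∈ Ω, s x < u x := by
  intro x₁ hx₁
  by_contra! hx₁'
  have hcl : IsCompact (closure Ω) := hbdd.isCompact_closure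
  have hcases : ∀ x ∈ closure Ω, x ∉ Ω → s x < u x := fun x hx hxΩ =>
    hbdry x ⟨hx, fun h => hxΩ (interior_subset h)⟩
  let i₀ : Fin N := ⟨0, hN⟩
  have hK : IsCompact (closure Ω ∩ (fun x => s x - u x) ⁻¹' {0}) :=
    hcl.of_isClosed_subset
      ((hs0.sub hu0).preimage_isClosed_of_isClosed isClosed_closure isClosed_singleton)
      inter_subset_left
  obtain ⟨L, hL, hKL, hLΩ⟩ := exists_compact_between hK hΩ (by
    rintro x ⟨hx, hx'⟩
    by_contra h
    have h1 : s x - u x = 0 := hx'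
    linarith [hcases x hx h])
  have hout : ∀ x ∈ closure Ω \ interior L, s x < u x := by
    rintro x ⟨hx, hxL⟩
    by_cases h : x ∈ Ω
    · refine lt_of_le_of_ne (hle x h) fun heq => hxL (hKL ⟨hx, ?_⟩)
      simp [heq]
    · exact hcases x hx h
  obtain ⟨δ, hδ, hgap⟩ := (hcl.diff isOpen_interior).exists_gap (hs0.mono sdiff_subset)
    (hu0.mono sdiff_subset) hout
  have huAt : ∀ x ∈ Ω, ContDiffAt ℝ 2 u x := fun x hx => hu2.contDiffAt (hΩ.mem_nhds hx)
  obtain ⟨P, hP, hPb⟩ := exists_abs_le_of_continuousOn hL (f := fun i x => pd u i x) fun i x hx =>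
    (differentiableAt_pd (huAt x (hLΩ hx)) i).continuousAt.continuousWithinAt
  obtain ⟨Q, -, hQb⟩ := exists_abs_le_of_continuousOn hL
    (f := fun (ij : Fin N × Fin N) x => pd2 u ij.1 ij.2 x) fun ij => by
      have h1 : ContinuousOn (fderiv ℝ (fderiv ℝ u)) Ω := fun x hx =>
        ((((huAt x hx).fderiv_right (m := 1) (by norm_num)).fderiv_right (m := 0)
          (by norm_num)).continuousAt).continuousWithinAt
      refine (((h1.clm_apply continuousOn_const).clm_apply continuousOn_const).mono hLΩ).congr
        fun x hx => pd2_eq_fderiv_fderiv (huAt x (hLΩ hx)) ij.1 ij.2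
  set C : ℝ := N * (N * (((P * P) * (2 * P + 1) + (1 + N * P ^ 2) * (2 * P + 1)) * Q)) with hC
  obtain ⟨α, hα, hαlarge⟩ : ∃ α : ℝ, 0 < α ∧ C < α * (1 / (1 + N * (P + 1) ^ 2)) := by
    have hpos : (0 : ℝ) < 1 + N * (P + 1) ^ 2 := by positivity
    refine ⟨(|C| + 1) * (1 + N * (P + 1) ^ 2), by positivity, ?_⟩
    rw [mul_assoc, mul_one_div_cancel hpos.ne']
    linarith [le_abs_self C]
  have hφ0 : ContinuousOn (fun z : Euc N => Real.exp (α * z i₀)) (closure Ω) :=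
    (contDiff_exp_coord α i₀).continuous.continuousOn
  obtain ⟨M, hM⟩ := hcl.exists_bound_of_continuousOn hφ0
  have hM' : ∀ x ∈ closure Ω, Real.exp (α * x i₀) ≤ M := fun x hx =>
    (le_abs_self _).trans (hM x hx)
  have hM0 : 0 < M := (Real.exp_pos _).trans_le (hM' x₁ (subset_closure hx₁))
  obtain ⟨η, hη, hη1, hη2⟩ : ∃ η > 0, η * (α * M) ≤ 1 ∧ η * M ≤ δ := by
    refine ⟨min (1 / (α * M)) (δ / M), by positivity, ?_, ?_⟩
    · exact (mul_le_mul_of_nonneg_right (min_le_left _ _) (by positivity)).trans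
        (one_div_mul_cancel (by positivity)).le
    · exact (mul_le_mul_of_nonneg_right (min_le_right _ _) hM0.le).trans
        (div_mul_cancel₀ _ hM0.ne').le
  obtain ⟨x, hx, hxmax⟩ := hcl.exists_isMaxOn ⟨x₁, subset_closure hx₁⟩
    ((hs0.add (continuousOn_const.mul hu0)).add (continuousOn_const.mul hφ0) :
      ContinuousOn (fun z => s z + (-1) * u z + η * Real.exp (α * z i₀)) (closure Ω))
  have hval : 0 < s x + (-1) * u x + η * Real.exp (α * x i₀) := by
    have h1 : s x₁ + (-1) * u x₁ + η * Real.exp (α * x₁ i₀)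
        ≤ s x + (-1) * u x + η * Real.exp (α * x i₀) := hxmax (subset_closure hx₁)
    have h2 : 0 < η * Real.exp (α * x₁ i₀) := by positivity
    linarith
  have hxL : x ∈ interior L := by
    by_contra h
    have h1 := hgap x ⟨hx, h⟩
    have h2 := mul_le_mul_of_nonneg_left (hM' x hx) hη.le
    linarith
  have hxL' := interior_subset hxL
  have hxΩ := hLΩ hxL'
  refine absurd (hsub x hxΩ) (not_le.2 (smeM_not_nonneg_of_isLocalMax hm i₀ (huAt x hxΩ)
    (hs2.contDiffAt (hΩ.mem_nhds hxΩ)) (hspos x hxΩ) (hle x hxΩ) hP (hPb x hxL')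
    (fun i j => hQb x hxL' (i, j)) hα hη ?_ hαlarge ?_ (husol x hxΩ)))
  · refine le_trans ?_ hη1
    gcongr
    exact hM' x hx
  · exact hxmax.isLocalMax (Filter.mem_of_superset (hΩ.mem_nhds hxΩ) subset_closure)

/-- Sliding family of subsolutions (Lemma (ii) of the paper):
if `u` is a positive solution of the SME on a bounded connected open set `Ω`,
continuous on `Ω̄`, and `{s_t}_{t ∈ [0,1)}` is a family of positive subsolutions,
continuous in `t` in the uniform norm on `Ω̄`, with `s_t < u` on `∂Ω` for `t ∈ (0,1)`
and `u ≥ s_tbar` on `Ω` for some `tbar ∈ (0,1)`, then `u ≥ s₀` on `Ω`. -/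
theorem sme_subsolution_sliding
    (m N : ℕ) (hm : 2 ≤ m) (hN : 2 ≤ N)
    (Ω : Set (Euc N)) (hΩ : IsOpen Ω) (hbdd : Bornology.IsBounded Ω) (hconn : IsConnected Ω)
    (u : Euc N → ℝ)
    (hu2 : ContDiffOn ℝ 2 u Ω) (hu0 : ContinuousOn u (closure Ω))
    (hupos : ∀ x ∈ closure Ω, 0 < u x)
    (husol : ∀ x ∈ Ω, smeM m u x = 0)
    (s : ℝ → Euc N → ℝ)
    (hs2 : ∀ t ∈ Ico (0:ℝ) 1, ContDiffOn ℝ 2 (s t) Ω)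
    (hs0 : ∀ t ∈ Ico (0:ℝ) 1, ContinuousOn (s t) (closure Ω))
    (hspos : ∀ t ∈ Ico (0:ℝ) 1, ∀ x ∈ closure Ω, 0 < s t x)
    (hscont : ∀ t₀ ∈ Ico (0:ℝ) 1, ∀ ε > (0:ℝ), ∃ δ > (0:ℝ), ∀ t ∈ Ico (0:ℝ) 1,
        |t - t₀| < δ → ∀ x ∈ closure Ω, |s t x - s t₀ x| < ε)
    (hsub : ∀ t ∈ Ico (0:ℝ) 1, ∀ x ∈ Ω, 0 ≤ smeM m (s t) x)
    (hbdry : ∀ t ∈ Ioo (0:ℝ) 1, ∀ x ∈ frontier Ω, s t x < u x)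
    (htbar : ∃ tbar ∈ Ioo (0:ℝ) 1, ∀ x ∈ Ω, s tbar x ≤ u x) :
    ∀ x ∈ Ω, s 0 x ≤ u x := by
  obtain ⟨tbar, htb, htle⟩ := htbar
  set T : Set ℝ := {t | t ∈ Icc 0 tbar ∧ ∀ x ∈ Ω, s t x ≤ u x} with hT
  have hTne : T.Nonempty := ⟨tbar, ⟨htb.1.le, le_rfl⟩, htle⟩
  have hTbd : BddBelow T := ⟨0, fun t ht => ht.1.1⟩
  have hIco : ∀ t ∈ Icc 0 tbar, t ∈ Ico (0 : ℝ) 1 := fun t ht => ⟨ht.1, ht.2.trans_lt htb.2⟩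
  set r := sInf T with hr
  have hr0 : 0 ≤ r := le_csInf hTne fun t ht => ht.1.1
  have hrI : r ∈ Icc 0 tbar := ⟨hr0, csInf_le hTbd ⟨⟨htb.1.le, le_rfl⟩, htle⟩⟩
  have hrle : ∀ x ∈ Ω, s r x ≤ u x := by
    intro x hx
    refine le_of_forall_pos_le_add fun ε hε => ?_
    obtain ⟨δ, hδ, hclose⟩ := hscont r (hIco r hrI) ε hε
    obtain ⟨t, htT, htr⟩ := exists_lt_of_csInf_lt hTne (show sInf T < r + δ by linarith)
    have h1 : r ≤ t := csInf_le hTbd htT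
    have h2 := hclose t (hIco t htT.1) (by rw [abs_of_nonneg] <;> linarith) x (subset_closure hx)
    linarith [(abs_lt.1 h2).1, htT.2 x hx]
  rcases hr0.eq_or_lt with h0 | h0
  · rwa [← h0] at hrle
  exfalso
  have hr1 := hIco r hrI
  have hlt := smeM_lt_of_le (by omega) (by omega) hΩ hbdd hu2 hu0 (hs2 r hr1) (hs0 r hr1)
    (fun x hx => hspos r hr1 x (subset_closure hx)) (fun x hx => (husol x hx).le) (hsub r hr1) hrle
    (hbdry r ⟨h0, hr1.2⟩)
  have hltcl : ∀ x ∈ closure Ω, s r x < u x := by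
    intro x hx
    by_cases h : x ∈ Ω
    · exact hlt x h
    · exact hbdry r ⟨h0, hr1.2⟩ x ⟨hx, fun h' => h (interior_subset h')⟩
  obtain ⟨ε, hε, hgap⟩ := hbdd.isCompact_closure.exists_gap (hs0 r hr1) hu0 hltcl
  obtain ⟨δ, hδ, hclose⟩ := hscont r hr1 ε hε
  set t := max 0 (r - δ / 2) with ht
  have htr : t < r := max_lt h0 (by linarith)
  have htI : t ∈ Icc 0 tbar := ⟨le_max_left _ _, htr.le.trans hrI.2⟩
  have htd : |t - r| < δ := by
    rw [abs_lt]
    constructor <;> linarith [le_max_right 0 (r - δ / 2)]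
  have htT : t ∈ T := by
    refine ⟨htI, fun x hx => ?_⟩
    have h1 := abs_lt.1 (hclose t (hIco t htI) htd x (subset_closure hx))
    linarith [hgap x (subset_closure hx), h1.2]
  linarith [csInf_le hTbd htT]
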